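/- Let α ∈ (0,2), α ≠ 1. For every quantum channel N: A→B, the α-Tsallis channel entropy is bounded: −(|B|^{α−1} − 1)/(α−1) ≤ S̃^T_α(N) ≤ (|B|^{1−α} − 1)/(1−α). -/

import Mathlib

open scoped Kronecker ComplexOrder

noncomputable section

namespace QIT

variable {n : Type*} [Fintype n] [DecidableEq n]

/-- Real trace of a complex matrix. -/
def rtr (A : Matrix n n ℂ) : ℝ := (Matrix.trace A).re

/-- Apply a real function to a hermitian matrix via spectral decomposition
(junk value `0` for non-hermitian input). -/
def mfun (f : ℝ → ℝ) (A : Matrix n n ℂ) : Matrix n n ℂ :=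
  if hA : A.IsHermitian then
    (Matrix.IsHermitian.eigenvectorUnitary hA : Matrix n n ℂ) *
      Matrix.diagonal (fun i => ((f (hA.eigenvalues i) : ℝ) : ℂ)) *
      (star (Matrix.IsHermitian.eigenvectorUnitary hA : Matrix n n ℂ))
  else 0

/-- Real power of a positive semidefinite matrix (with the conventions
`0 ^ p = 0` for `p ≠ 0`, i.e. powers are taken on the support). -/
def mpow (A : Matrix n n ℂ) (p : ℝ) : Matrix n n ℂ := mfun (fun x => x ^ p) A

/-- Matrix base-2 logarithm (on the support). -/
def mlog (A : Matrix n n ℂ) : Matrix n n ℂ := mfun (Real.logb 2) A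

/-- A quantum state: positive semidefinite with unit trace. -/
def IsState (ρ : Matrix n n ℂ) : Prop := ρ.PosSemidef ∧ Matrix.trace ρ = 1

/-- A pure state: a state of rank one. -/
def IsPureState (ρ : Matrix n n ℂ) : Prop := IsState ρ ∧ ρ.rank = 1

/-- The support (range) ordering: `supp ρ ⊆ supp σ`, expressed as
`ker σ ≤ ker ρ`. -/
def SuppLE (ρ σ : Matrix n n ℂ) : Prop := ∀ v : n → ℂ, σ.mulVec v = 0 → ρ.mulVec v = 0

/-- Trace norm ‖X‖₁ = Tr √(X† X). -/
def traceNorm (X : Matrix n n ℂ) : ℝ := rtr (mpow (X.conjTranspose * X) (2⁻¹ : ℝ))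

/-- von Neumann entropy (base 2). -/
def vnEnt (ρ : Matrix n n ℂ) : ℝ := - rtr (ρ * mlog ρ)

/-- Umegaki relative entropy (base 2), real-valued on its finiteness domain. -/
def relEnt (ρ σ : Matrix n n ℂ) : ℝ := rtr (ρ * mlog ρ) - rtr (ρ * mlog σ)

/-- The sandwiched trace functional Tr{(σ^((1-α)/(2α)) ρ σ^((1-α)/(2α)))^α}. -/
def sandTr (α : ℝ) (ρ σ : Matrix n n ℂ) : ℝ :=
  rtr (mpow (mpow σ ((1 - α) / (2 * α)) * ρ * mpow σ ((1 - α) / (2 * α))) α)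

/-- Sandwiched Rényi relative entropy (base 2). -/
def sandRenyi (α : ℝ) (ρ σ : Matrix n n ℂ) : ℝ := (α - 1)⁻¹ * Real.logb 2 (sandTr α ρ σ)

/-- Sandwiched Tsallis relative entropy. -/
def sandTsallis (α : ℝ) (ρ σ : Matrix n n ℂ) : ℝ := (α - 1)⁻¹ * (sandTr α ρ σ - 1)

/-- (Non-sandwiched) Tsallis relative entropy. -/
def tsallisRel (α : ℝ) (ρ σ : Matrix n n ℂ) : ℝ :=
  (α - 1)⁻¹ * (rtr (mpow ρ α * mpow σ (1 - α)) - 1)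

/-- Tsallis entropy of a state. -/
def tsallisEnt (α : ℝ) (ρ : Matrix n n ℂ) : ℝ := (1 - α)⁻¹ * (rtr (mpow ρ α) - 1)

variable {a b c r : Type*} [Fintype a] [DecidableEq a] [Fintype b] [DecidableEq b]
  [Fintype c] [DecidableEq c] [Fintype r] [DecidableEq r]

/-- Partial trace over the first tensor factor. -/
def ptraceA (ρ : Matrix (a × b) (a × b) ℂ) : Matrix b b ℂ :=
  Matrix.of fun i j => ∑ k : a, ρ (k, i) (k, j)

/-- Partial trace over the second tensor factor. -/
def ptraceB (ρ : Matrix (a × b) (a × b) ℂ) : Matrix a a ℂ :=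
  Matrix.of fun i j => ∑ k : b, ρ (i, k) (j, k)

/-- Conditional sandwiched Rényi entropy H̃↓_α(A|B). -/
def condRenyiDown (α : ℝ) (ρ : Matrix (a × b) (a × b) ℂ) : ℝ :=
  - sandRenyi α ρ ((1 : Matrix a a ℂ) ⊗ₖ ptraceA ρ)

/-- Conditional sandwiched Tsallis entropy T̃↓_α(A|B). -/
def condTsallisSandDown (α : ℝ) (ρ : Matrix (a × b) (a × b) ℂ) : ℝ :=
  - sandTsallis α ρ ((1 : Matrix a a ℂ) ⊗ₖ ptraceA ρ)

/-- Optimized conditional sandwiched Tsallis entropy T̃↑_α(A|B). -/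
def condTsallisSandUp (α : ℝ) (ρ : Matrix (a × b) (a × b) ℂ) : ℝ :=
  - ⨅ σ : {σ : Matrix b b ℂ // IsState σ}, sandTsallis α ρ ((1 : Matrix a a ℂ) ⊗ₖ σ.1)

/-- Conditional (non-sandwiched) Tsallis entropy T↓_α(A|B). -/
def condTsallisDown (α : ℝ) (ρ : Matrix (a × b) (a × b) ℂ) : ℝ :=
  - tsallisRel α ρ ((1 : Matrix a a ℂ) ⊗ₖ ptraceA ρ)

/-- Conditional von Neumann entropy H(A|B) = S(AB) - S(B). -/
def condvnEnt (ρ : Matrix (a × b) (a × b) ℂ) : ℝ := vnEnt ρ - vnEnt (ptraceA ρ)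

/-- The extension `N ⊗ I_r` of a linear map on matrices. -/
def tensorId (N : Matrix a a ℂ →ₗ[ℂ] Matrix b b ℂ) (r : Type*) [Fintype r] [DecidableEq r] :
    Matrix (a × r) (a × r) ℂ →ₗ[ℂ] Matrix (b × r) (b × r) ℂ where
  toFun ρ := Matrix.of fun p q => N (Matrix.of fun x y => ρ (x, p.2) (y, q.2)) p.1 q.1
  map_add' ρ₁ ρ₂ := by
    ext p q
    have h : (Matrix.of fun x y => (ρ₁ + ρ₂) (x, p.2) (y, q.2))
        = (Matrix.of fun x y => ρ₁ (x, p.2) (y, q.2))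
          + (Matrix.of fun x y => ρ₂ (x, p.2) (y, q.2)) := by
      ext x y; simp
    show N (Matrix.of fun x y => (ρ₁ + ρ₂) (x, p.2) (y, q.2)) p.1 q.1 = _
    rw [h, map_add]; rfl
  map_smul' z ρ := by
    ext p q
    have h : (Matrix.of fun x y => (z • ρ) (x, p.2) (y, q.2))
        = z • (Matrix.of fun x y => ρ (x, p.2) (y, q.2)) := by
      ext x y; simp
    show N (Matrix.of fun x y => (z • ρ) (x, p.2) (y, q.2)) p.1 q.1 = _
    rw [h, map_smul]; rfl

/-- The extension `I_r ⊗ M` of a linear map on matrices. -/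
def idTensor (M : Matrix a a ℂ →ₗ[ℂ] Matrix b b ℂ) (r : Type*) [Fintype r] [DecidableEq r] :
    Matrix (r × a) (r × a) ℂ →ₗ[ℂ] Matrix (r × b) (r × b) ℂ where
  toFun ρ := Matrix.of fun p q => M (Matrix.of fun x y => ρ (p.1, x) (q.1, y)) p.2 q.2
  map_add' ρ₁ ρ₂ := by
    ext p q
    have h : (Matrix.of fun x y => (ρ₁ + ρ₂) (p.1, x) (q.1, y))
        = (Matrix.of fun x y => ρ₁ (p.1, x) (q.1, y))
          + (Matrix.of fun x y => ρ₂ (p.1, x) (q.1, y)) := by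
      ext x y; simp
    show M (Matrix.of fun x y => (ρ₁ + ρ₂) (p.1, x) (q.1, y)) p.2 q.2 = _
    rw [h, map_add]; rfl
  map_smul' z ρ := by
    ext p q
    have h : (Matrix.of fun x y => (z • ρ) (p.1, x) (q.1, y))
        = z • (Matrix.of fun x y => ρ (p.1, x) (q.1, y)) := by
      ext x y; simp
    show M (Matrix.of fun x y => (z • ρ) (p.1, x) (q.1, y)) p.2 q.2 = _
    rw [h, map_smul]; rfl

/-- A quantum channel: trace preserving and completely positive. -/
def IsChannel (N : Matrix a a ℂ →ₗ[ℂ] Matrix b b ℂ) : Prop :=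
  (∀ ρ : Matrix a a ℂ, Matrix.trace (N ρ) = Matrix.trace ρ) ∧
  ∀ (k : ℕ) (ρ : Matrix (a × Fin k) (a × Fin k) ℂ), ρ.PosSemidef →
    (tensorId N (Fin k) ρ).PosSemidef

/-- The maximally mixed state on system `b`. -/
def maxMixed (b : Type*) [Fintype b] [DecidableEq b] : Matrix b b ℂ :=
  ((Fintype.card b : ℂ))⁻¹ • (1 : Matrix b b ℂ)

/-- The completely randomizing (depolarizing) channel. -/
def randomizing (a b : Type*) [Fintype a] [DecidableEq a] [Fintype b] [DecidableEq b] :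
    Matrix a a ℂ →ₗ[ℂ] Matrix b b ℂ :=
  (Matrix.traceLinearMap a ℂ ℂ).smulRight (maxMixed b)

/-- The replacer channel `ρ ↦ Tr(ρ) σ`. -/
def replacer (a : Type*) [Fintype a] [DecidableEq a] (σ : Matrix b b ℂ) :
    Matrix a a ℂ →ₗ[ℂ] Matrix b b ℂ :=
  (Matrix.traceLinearMap a ℂ ℂ).smulRight σ

/-- Channel (Umegaki) relative entropy: supremum over all finite reference systems. -/
def chRelEnt (N M : Matrix a a ℂ →ₗ[ℂ] Matrix b b ℂ) : ℝ :=
  ⨆ p : Σ k : ℕ, {ρ : Matrix (a × Fin k) (a × Fin k) ℂ // IsState ρ},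
    relEnt (tensorId N (Fin p.1) p.2.1) (tensorId M (Fin p.1) p.2.1)

/-- Channel sandwiched Rényi relative entropy. -/
def chSandRenyi (α : ℝ) (N M : Matrix a a ℂ →ₗ[ℂ] Matrix b b ℂ) : ℝ :=
  ⨆ p : Σ k : ℕ, {ρ : Matrix (a × Fin k) (a × Fin k) ℂ // IsState ρ},
    sandRenyi α (tensorId N (Fin p.1) p.2.1) (tensorId M (Fin p.1) p.2.1)

/-- Channel sandwiched Tsallis relative entropy. -/
def chSandTsallis (α : ℝ) (N M : Matrix a a ℂ →ₗ[ℂ] Matrix b b ℂ) : ℝ :=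
  ⨆ p : Σ k : ℕ, {ρ : Matrix (a × Fin k) (a × Fin k) ℂ // IsState ρ},
    sandTsallis α (tensorId N (Fin p.1) p.2.1) (tensorId M (Fin p.1) p.2.1)

/-- Diamond distance between two maps. -/
def diamondDist (N M : Matrix a a ℂ →ₗ[ℂ] Matrix b b ℂ) : ℝ :=
  ⨆ p : Σ k : ℕ, {ρ : Matrix (a × Fin k) (a × Fin k) ℂ // IsState ρ},
    traceNorm (tensorId N (Fin p.1) p.2.1 - tensorId M (Fin p.1) p.2.1)

/-- Entropy of a quantum channel. -/
def chEnt (N : Matrix a a ℂ →ₗ[ℂ] Matrix b b ℂ) : ℝ :=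
  Real.logb 2 (Fintype.card b) - chRelEnt N (randomizing a b)

/-- α-Rényi entropy of a quantum channel. -/
def chRenyiEnt (α : ℝ) (N : Matrix a a ℂ →ₗ[ℂ] Matrix b b ℂ) : ℝ :=
  Real.logb 2 (Fintype.card b) - chSandRenyi α N (randomizing a b)

/-- α-Tsallis entropy of a quantum channel. -/
def chTsallisEnt (α : ℝ) (N : Matrix a a ℂ →ₗ[ℂ] Matrix b b ℂ) : ℝ :=
  ((Fintype.card b : ℝ) ^ (1 - α) - 1) / (1 - α)
    - (Fintype.card b : ℝ) ^ (1 - α) * chSandTsallis α N (randomizing a b)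


section MatrixAnalysis

set_option linter.unusedSectionVars false

open Matrix
open scoped MatrixOrder Matrix.Norms.L2Operator


lemma mfun_eq_cfc (f : ℝ → ℝ) {A : Matrix n n ℂ} (hA : A.IsHermitian) : mfun f A = cfc f A := by
  rw [hA.cfc_eq, mfun, dif_pos hA, Matrix.IsHermitian.cfc, Unitary.conjStarAlgAut_apply]
  rfl

lemma continuousOn_spectrum (f : ℝ → ℝ) (A : Matrix n n ℂ) : ContinuousOn f (spectrum ℝ A) :=
  Matrix.finite_real_spectrum.continuousOn f

lemma rtr_mul_nonneg {A B : Matrix n n ℂ} (hA : 0 ≤ A) (hB : 0 ≤ B) : 0 ≤ rtr (A * B) := by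
  obtain ⟨C, rfl⟩ := CStarAlgebra.nonneg_iff_eq_star_mul_self.mp hA
  have h := (hB.posSemidef.mul_mul_conjTranspose_same C).trace_nonneg
  rw [rtr, Matrix.mul_assoc, Matrix.trace_mul_comm]
  exact (Complex.nonneg_iff.mp h).1

lemma rtr_mul_le_rtr_mul {X A B : Matrix n n ℂ} (hX : 0 ≤ X) (hAB : A ≤ B) :
    rtr (X * A) ≤ rtr (X * B) := by
  have h := rtr_mul_nonneg hX (sub_nonneg.mpr hAB)
  rw [rtr, Matrix.mul_sub, Matrix.trace_sub, Complex.sub_re] at h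
  exact sub_nonneg.mp h

lemma rtr_le_rtr {A B : Matrix n n ℂ} (hAB : A ≤ B) : rtr A ≤ rtr B := by
  simpa using rtr_mul_le_rtr_mul (zero_le_one : (0 : Matrix n n ℂ) ≤ 1) hAB

/-- In an eigenbasis of `S`, tracing `P` against functions of `S` only sees the diagonal of `P`. -/
lemma exists_rtr_mul_cfc_eq_sum {P S : Matrix n n ℂ} {c : ℝ} (hS : S.IsHermitian) (hP : 0 ≤ P)
    (hPS : P ≤ c • S) :
    ∃ p : n → ℝ, (∀ i, 0 ≤ p i) ∧ (∀ i, p i ≤ c * hS.eigenvalues i) ∧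
      ∀ f : ℝ → ℝ, rtr (P * cfc f S) = ∑ i, f (hS.eigenvalues i) * p i := by
  set U : Matrix n n ℂ := (hS.eigenvectorUnitary : Matrix n n ℂ) with hU
  have hUU : star U * U = 1 := Unitary.coe_star_mul_self hS.eigenvectorUnitary
  have hcfc (f : ℝ → ℝ) : cfc f S =
      U * Matrix.diagonal (fun i => ((f (hS.eigenvalues i) : ℝ) : ℂ)) * star U := by
    rw [← mfun_eq_cfc f hS, mfun, dif_pos hS]
  have hSU : star U * S * U = Matrix.diagonal (fun i => ((hS.eigenvalues i : ℝ) : ℂ)) := by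
    have h := hcfc id
    rw [cfc_id ℝ S hS.isSelfAdjoint] at h
    conv_lhs => rw [h]
    simp only [id, ← Matrix.mul_assoc, hUU, Matrix.one_mul]
    rw [Matrix.mul_assoc, hUU, Matrix.mul_one]
  refine ⟨fun i => ((star U * P * U) i i).re, fun i => ?_, fun i => ?_, fun f => ?_⟩
  · have h := (hP.posSemidef.conjTranspose_mul_mul_same U).diag_nonneg (i := i)
    exact (Complex.nonneg_iff.mp h).1
  · have h := ((Matrix.le_iff.mp hPS).conjTranspose_mul_mul_same U).diag_nonneg (i := i)
    have h' : star U * (c • S - P) * U = c • (star U * S * U) - star U * P * U := by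
      simp [Matrix.mul_sub, Matrix.sub_mul]
    rw [← Matrix.star_eq_conjTranspose, h', hSU] at h
    have := (Complex.nonneg_iff.mp h).1
    simpa using this
  · rw [hcfc, ← Matrix.mul_assoc, rtr, Matrix.trace_mul_comm, ← Matrix.mul_assoc,
      ← Matrix.mul_assoc, Matrix.trace, Complex.re_sum]
    refine Finset.sum_congr rfl fun i _ => ?_
    rw [Matrix.diag_apply, Matrix.mul_diagonal]
    simp [mul_comm]

lemma cfc_rpow_le_cfc_rpow {A B : Matrix n n ℂ} {p : ℝ} (hp : p ∈ Set.Icc (0 : ℝ) 1)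
    (hA : 0 ≤ A) (hAB : A ≤ B) : cfc (fun x : ℝ => x ^ p) A ≤ cfc (fun x : ℝ => x ^ p) B := by
  rw [← CFC.rpow_eq_cfc_real hA, ← CFC.rpow_eq_cfc_real (hA.trans hAB)]
  exact CFC.rpow_le_rpow hp hAB

lemma cfc_add_rpow_neg_antitone {A B : Matrix n n ℂ} {p ε : ℝ} (hp : p ∈ Set.Icc (-1 : ℝ) 0)
    (hε : 0 < ε) (hA : 0 ≤ A) (hAB : A ≤ B) :
    cfc (fun x : ℝ => (x + ε) ^ p) B ≤ cfc (fun x : ℝ => (x + ε) ^ p) A := by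
  have key (C : Matrix n n ℂ) (hC : 0 ≤ C) :
      cfc (fun x : ℝ => (x + ε) ^ p) C = ((C + algebraMap ℝ _ ε) ^ (-1 : ℝ)) ^ (-p) := by
    have h0 : 0 ≤ C + algebraMap ℝ (Matrix n n ℂ) ε :=
      add_nonneg hC (algebraMap_nonneg _ hε.le)
    have h1 : C + algebraMap ℝ (Matrix n n ℂ) ε = cfc (fun x : ℝ => x + ε) C := by
      rw [cfc_add_const _ _ _ (continuousOn_spectrum _ _), cfc_id' ℝ C]
    rw [CFC.rpow_eq_cfc_real CFC.rpow_nonneg, CFC.rpow_eq_cfc_real h0, h1,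
      ← cfc_comp' (fun x : ℝ => x ^ (-1 : ℝ)) (fun x => x + ε) C
        (((Matrix.finite_real_spectrum).image _).continuousOn _) (continuousOn_spectrum _ _),
      ← cfc_comp' (fun x : ℝ => x ^ (-p)) (fun x => (x + ε) ^ (-1 : ℝ)) C
        (((Matrix.finite_real_spectrum).image _).continuousOn _) (continuousOn_spectrum _ _)]
    refine cfc_congr fun x hx => ?_
    have hx0 : 0 ≤ x := spectrum_nonneg_of_nonneg hC hx
    rw [← Real.rpow_mul (by positivity)]
    simp
  rw [key A hA, key B (hA.trans hAB)]
  refine CFC.rpow_le_rpow ⟨by linarith [hp.2], by linarith [hp.1]⟩ ?_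
  refine CStarAlgebra.rpow_neg_one_le_rpow_neg_one (by gcongr) ?_
  refine IsStrictlyPositive.nonneg_add hA ?_
  grind

lemma conj_cfc_cfc (f g : ℝ → ℝ) {S : Matrix n n ℂ} :
    cfc f S * cfc g S * cfc f S = cfc (fun x => f x * g x * f x) S := by
  rw [cfc_mul (fun x => f x * g x) f S (continuousOn_spectrum _ _) (continuousOn_spectrum _ _),
    cfc_mul f g S (continuousOn_spectrum _ _) (continuousOn_spectrum _ _)]

lemma cfc_id_mul (f : ℝ → ℝ) {X : Matrix n n ℂ} (hX : X.IsHermitian) :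
    cfc (fun x => x * f x) X = X * cfc f X := by
  rw [cfc_mul (fun x => x) f X (continuousOn_spectrum _ _) (continuousOn_spectrum _ _),
    cfc_id' ℝ X hX.isSelfAdjoint]

/-- The sandwiching exponent `s` makes a rescaled `x ^ (2 * s + 1)` collapse to a constant. -/
lemma sandwich_rpow_eq {α c x : ℝ} (hα : 0 < α) (hc : 0 < c) (hx : 0 < x) :
    x ^ ((1 - α) / (2 * α)) *
      (x ^ ((1 - α) / (2 * α)) * (c * x) * x ^ ((1 - α) / (2 * α))) ^ (α - 1) *
      x ^ ((1 - α) / (2 * α)) = c ^ (α - 1) := by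
  set s := (1 - α) / (2 * α) with hs
  have h1 : x ^ s * (c * x) * x ^ s = c * x ^ (s + 1 + s) := by
    rw [Real.rpow_add hx, Real.rpow_add hx, Real.rpow_one]; ring
  rw [h1, Real.mul_rpow hc.le (by positivity), ← Real.rpow_mul hx.le]
  have h2 : x ^ s * (c ^ (α - 1) * x ^ ((s + 1 + s) * (α - 1))) * x ^ s
      = c ^ (α - 1) * x ^ (s + (s + 1 + s) * (α - 1) + s) := by
    rw [Real.rpow_add hx, Real.rpow_add hx]; ring
  have h3 : s + (s + 1 + s) * (α - 1) + s = 0 := by rw [hs]; field_simp; ring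
  rw [h2, h3, Real.rpow_zero, mul_one]

section Sandwiched

variable {P S : Matrix n n ℂ} {α c : ℝ}

lemma conj_cfc_nonneg (hP : 0 ≤ P) (f : ℝ → ℝ) : 0 ≤ cfc f S * P * cfc f S := by
  have h : IsSelfAdjoint (cfc f S) := cfc_predicate f S
  exact h.conjugate_nonneg hP

lemma sandTr_eq_rtr_cfc (hP : 0 ≤ P) (hS : 0 ≤ S) :
    sandTr α P S = rtr (cfc (fun x : ℝ => x ^ α)
      (cfc (fun x : ℝ => x ^ ((1 - α) / (2 * α))) S * P *
        cfc (fun x : ℝ => x ^ ((1 - α) / (2 * α))) S)) := by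
  have h : 0 ≤ cfc (fun x : ℝ => x ^ ((1 - α) / (2 * α))) S * P *
      cfc (fun x : ℝ => x ^ ((1 - α) / (2 * α))) S :=
    conj_cfc_nonneg hP _
  rw [sandTr, mpow, mpow, mfun_eq_cfc _ hS.posSemidef.isHermitian,
    mfun_eq_cfc _ h.posSemidef.isHermitian]

lemma conj_cfc_le (hS : 0 ≤ S) (hPS : P ≤ c • S) (f : ℝ → ℝ) :
    cfc f S * P * cfc f S ≤ cfc (fun x => f x * (c * x) * f x) S := by
  have h : cfc (fun x => c * x) S = c • S := cfc_const_mul_id c S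
  rw [← conj_cfc_cfc f (fun x => c * x), h]
  have hf : IsSelfAdjoint (cfc f S) := cfc_predicate f S
  exact hf.conjugate_le_conjugate hPS

lemma rtr_conj_mul (T P Z : Matrix n n ℂ) : rtr (T * P * T * Z) = rtr (P * (T * Z * T)) := by
  rw [rtr, rtr, Matrix.mul_assoc, Matrix.mul_assoc, Matrix.trace_mul_comm]
  simp only [Matrix.mul_assoc]

/-- `D̃_α ≤ D_max` for `1 < α ≤ 2`. -/
lemma sandTr_le_of_le_smul (hα : 1 < α) (hα2 : α ≤ 2) (hc : 0 < c) (hP : 0 ≤ P)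
    (hPtr : rtr P = 1) (hS : 0 ≤ S) (hPS : P ≤ c • S) : sandTr α P S ≤ c ^ (α - 1) := by
  rw [sandTr_eq_rtr_cfc hP hS]
  have hα0 : 0 < α := by linarith
  set s := (1 - α) / (2 * α) with hs
  set T := cfc (fun x : ℝ => x ^ s) S
  have hX : 0 ≤ T * P * T := conj_cfc_nonneg hP _
  have hpow : cfc (fun x : ℝ => x ^ α) (T * P * T)
      = T * P * T * cfc (fun x : ℝ => x ^ (α - 1)) (T * P * T) := by
    rw [← cfc_id_mul _ hX.posSemidef.isHermitian]
    refine cfc_congr fun x hx => ?_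
    rcases (spectrum_nonneg_of_nonneg hX hx).eq_or_lt with rfl | h
    · simp [hα0.ne']
    · rw [← Real.rpow_one_add' h.le (by linarith)]; ring_nf
  have hle := rtr_mul_le_rtr_mul hX (cfc_rpow_le_cfc_rpow (p := α - 1)
    ⟨by linarith, by linarith⟩ hX (conj_cfc_le hS hPS _))
  rw [← cfc_comp' (fun x : ℝ => x ^ (α - 1)) _ S
    (((Matrix.finite_real_spectrum).image _).continuousOn _) (continuousOn_spectrum _ _),
    rtr_conj_mul _ _ (cfc _ S), conj_cfc_cfc] at hle
  rw [hpow]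
  refine hle.trans ?_
  obtain ⟨p, hp0, -, hp⟩ := exists_rtr_mul_cfc_eq_sum hS.posSemidef.isHermitian hP hPS
  have hsum : ∑ i, p i = 1 := by
    have h := hp fun _ => 1
    rw [cfc_const_one ℝ S, Matrix.mul_one, hPtr] at h
    simpa using h.symm
  rw [hp, show c ^ (α - 1) = ∑ i, c ^ (α - 1) * p i by rw [← Finset.mul_sum, hsum, mul_one]]
  refine Finset.sum_le_sum fun i _ => mul_le_mul_of_nonneg_right ?_ (hp0 i)
  rcases (hS.posSemidef.eigenvalues_nonneg i).eq_or_lt with h | h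
  · have hs0 : s ≠ 0 := div_ne_zero (by linarith) (by linarith)
    rw [← h, Real.zero_rpow hs0]
    simp only [mul_zero]
    positivity
  · exact (sandwich_rpow_eq hα0 hc h).le

/-- `D̃_α ≤ D_max` for `0 < α < 1`. -/
lemma le_sandTr_of_le_smul (hα0 : 0 < α) (hα : α < 1) (hc : 0 < c) (hP : 0 ≤ P)
    (hPtr : rtr P = 1) (hS : 0 ≤ S) (hPS : P ≤ c • S) : c ^ (α - 1) ≤ sandTr α P S := by
  rw [sandTr_eq_rtr_cfc hP hS]
  set s := (1 - α) / (2 * α) with hs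
  set T := cfc (fun x : ℝ => x ^ s) S
  have hX : 0 ≤ T * P * T := conj_cfc_nonneg hP _
  obtain ⟨p, hp0, hpS, hp⟩ := exists_rtr_mul_cfc_eq_sum hS.posSemidef.isHermitian hP hPS
  have hsum : ∑ i, p i = 1 := by
    have h := hp fun _ => 1
    rw [cfc_const_one ℝ S, Matrix.mul_one, hPtr] at h
    simpa using h.symm
  set e := hS.posSemidef.isHermitian.eigenvalues
  have hbound (ε : ℝ) (hε : 0 < ε) :
      ∑ i, e i ^ s * (e i ^ s * (c * e i) * e i ^ s + ε) ^ (α - 1) * e i ^ s * p i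
        ≤ rtr (cfc (fun x : ℝ => x ^ α) (T * P * T)) := by
    have hmono : T * P * T * cfc (fun x : ℝ => (x + ε) ^ (α - 1)) (T * P * T)
        ≤ cfc (fun x : ℝ => x ^ α) (T * P * T) := by
      rw [← cfc_id_mul _ hX.posSemidef.isHermitian]
      refine cfc_mono (fun x hx => ?_) (continuousOn_spectrum _ _) (continuousOn_spectrum _ _)
      rcases (spectrum_nonneg_of_nonneg hX hx).eq_or_lt with rfl | h
      · simp [hα0.ne']
      · calc x * (x + ε) ^ (α - 1) ≤ x * x ^ (α - 1) := by
              refine mul_le_mul_of_nonneg_left ?_ h.le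
              exact Real.rpow_le_rpow_of_nonpos h (by linarith) (by linarith)
          _ = x ^ α := by rw [← Real.rpow_one_add' h.le (by linarith)]; ring_nf
    refine le_trans ?_ (rtr_le_rtr hmono)
    have hle := rtr_mul_le_rtr_mul hX (cfc_add_rpow_neg_antitone (p := α - 1)
      ⟨by linarith, by linarith⟩ hε hX (conj_cfc_le hS hPS _))
    rw [← cfc_comp' (fun x : ℝ => (x + ε) ^ (α - 1)) _ S
      (((Matrix.finite_real_spectrum).image _).continuousOn _) (continuousOn_spectrum _ _),
      rtr_conj_mul _ _ (cfc _ S), conj_cfc_cfc, hp] at hle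
    exact hle
  have hlim : Filter.Tendsto
      (fun ε : ℝ => ∑ i, e i ^ s * (e i ^ s * (c * e i) * e i ^ s + ε) ^ (α - 1) * e i ^ s * p i)
      (nhdsWithin 0 (Set.Ioi 0)) (nhds (∑ i, c ^ (α - 1) * p i)) := by
    refine tendsto_finsetSum _ fun i _ => ?_
    have he0 : 0 ≤ e i := hS.posSemidef.eigenvalues_nonneg i
    rcases he0.eq_or_lt with h | he
    · have : p i = 0 := le_antisymm (by simpa [← h] using hpS i) (hp0 i)
      simp [this]
    · have hy : 0 < e i ^ s * (c * e i) * e i ^ s := by positivity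
      refine Filter.Tendsto.mul_const _ ?_
      rw [← sandwich_rpow_eq hα0 hc he]
      refine (Filter.Tendsto.const_mul _ ?_).mul_const _
      refine Filter.Tendsto.rpow_const ?_ (Or.inl hy.ne')
      refine Filter.Tendsto.mono_left ?_ nhdsWithin_le_nhds
      exact Continuous.tendsto' (by fun_prop) _ _ (by rw [add_zero, hs])
  rw [← Finset.mul_sum, hsum, mul_one] at hlim
  exact le_of_tendsto hlim (eventually_nhdsWithin_of_forall hbound)

end Sandwiched

section MaximallyMixed

variable {P : Matrix n n ℂ} {α : ℝ}

lemma rtr_cfc_affine (u v : ℝ) {X : Matrix n n ℂ} (hX : X.IsHermitian) :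
    rtr (cfc (fun x => u + v * x) X) = u * Fintype.card n + v * rtr X := by
  rw [cfc_const_add u (fun x => v * x) X (continuousOn_spectrum _ _) hX.isSelfAdjoint,
    cfc_const_mul_id v X hX.isSelfAdjoint, Algebra.algebraMap_eq_smul_one]
  simp [rtr]

variable [Nonempty n]

lemma sandTr_inv_card_smul_one (hP : 0 ≤ P) :
    sandTr α P ((Fintype.card n : ℝ)⁻¹ • 1) = rtr (cfc (fun x : ℝ => x ^ α)
      ((((Fintype.card n : ℝ)⁻¹ ^ ((1 - α) / (2 * α))) ^ 2) • P)) := by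
  have hd : (0 : ℝ) ≤ (Fintype.card n : ℝ)⁻¹ := by positivity
  have h1 : (0 : Matrix n n ℂ) ≤ (Fintype.card n : ℝ)⁻¹ • 1 := smul_nonneg hd zero_le_one
  rw [sandTr_eq_rtr_cfc hP h1, ← Algebra.algebraMap_eq_smul_one, cfc_algebraMap,
    Algebra.algebraMap_eq_smul_one]
  simp [smul_smul, sq]

lemma mean_rpow_eq_inv_card (hα : 0 < α) :
    ((((Fintype.card n : ℝ)⁻¹ ^ ((1 - α) / (2 * α))) ^ 2) * (Fintype.card n : ℝ)⁻¹) ^ α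
      = (Fintype.card n : ℝ)⁻¹ := by
  have hd : (0 : ℝ) < (Fintype.card n : ℝ)⁻¹ := by positivity
  rw [← Real.rpow_natCast, ← Real.rpow_mul hd.le, ← Real.rpow_add_one hd.ne',
    ← Real.rpow_mul hd.le]
  have : ((1 - α) / (2 * α) * (2 : ℕ) + 1) * α = 1 := by push_cast; field_simp; ring
  rw [this, Real.rpow_one]

/-- The affine comparison functions below are tangent to `x ↦ x ^ α` at the mean `m`. -/
lemma rtr_cfc_tangent_eq_one (hα : 0 < α) (hP : 0 ≤ P) (hPtr : rtr P = 1) {t m : ℝ}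
    (ht : t = ((Fintype.card n : ℝ)⁻¹ ^ ((1 - α) / (2 * α))) ^ 2)
    (hm : m = t * (Fintype.card n : ℝ)⁻¹) :
    rtr (cfc (fun x => m ^ α * (1 - α) + m ^ α * (α / m) * x) (t • P)) = 1 := by
  have hd : (0 : ℝ) < (Fintype.card n : ℝ) := by positivity
  have ht0 : 0 < t := by rw [ht]; positivity
  have htP : 0 ≤ t • P := smul_nonneg ht0.le hP
  have h : rtr (t • P) = t := by
    have : rtr (t • P) = t * rtr P := by simp [rtr]
    rw [this, hPtr, mul_one]
  rw [rtr_cfc_affine _ _ htP.posSemidef.isHermitian, h]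
  have h2 : m ^ α = (Fintype.card n : ℝ)⁻¹ := by
    rw [hm, ht, mean_rpow_eq_inv_card hα]
  rw [h2, hm]
  field_simp
  ring

lemma one_le_sandTr_inv_card_smul_one (hα : 1 < α) (hP : 0 ≤ P) (hPtr : rtr P = 1) :
    1 ≤ sandTr α P ((Fintype.card n : ℝ)⁻¹ • 1) := by
  rw [sandTr_inv_card_smul_one hP]
  set t := ((Fintype.card n : ℝ)⁻¹ ^ ((1 - α) / (2 * α))) ^ 2 with ht
  have ht0 : 0 < t := by rw [ht]; positivity
  set m := t * (Fintype.card n : ℝ)⁻¹ with hm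
  have hm0 : 0 < m := by positivity
  rw [← rtr_cfc_tangent_eq_one (by linarith) hP hPtr ht hm]
  refine rtr_le_rtr (cfc_mono (fun x hx => ?_) (continuousOn_spectrum _ _)
    (continuousOn_spectrum _ _))
  have hx0 : 0 ≤ x := spectrum_nonneg_of_nonneg (smul_nonneg ht0.le hP) hx
  have hb := one_add_mul_self_le_rpow_one_add (s := x / m - 1)
    (by have := div_nonneg hx0 hm0.le; linarith) hα.le
  rw [add_sub_cancel, Real.div_rpow hx0 hm0.le, le_div_iff₀ (by positivity)] at hb
  refine le_trans (le_of_eq ?_) hb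
  ring

lemma sandTr_inv_card_smul_one_le_one (hα0 : 0 < α) (hα : α < 1) (hP : 0 ≤ P)
    (hPtr : rtr P = 1) : sandTr α P ((Fintype.card n : ℝ)⁻¹ • 1) ≤ 1 := by
  rw [sandTr_inv_card_smul_one hP]
  set t := ((Fintype.card n : ℝ)⁻¹ ^ ((1 - α) / (2 * α))) ^ 2 with ht
  have ht0 : 0 < t := by rw [ht]; positivity
  set m := t * (Fintype.card n : ℝ)⁻¹ with hm
  have hm0 : 0 < m := by positivity
  rw [← rtr_cfc_tangent_eq_one hα0 hP hPtr ht hm]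
  refine rtr_le_rtr (cfc_mono (fun x hx => ?_) (continuousOn_spectrum _ _)
    (continuousOn_spectrum _ _))
  have hx0 : 0 ≤ x := spectrum_nonneg_of_nonneg (smul_nonneg ht0.le hP) hx
  have hb := rpow_one_add_le_one_add_mul_self (s := x / m - 1)
    (by have := div_nonneg hx0 hm0.le; linarith) hα0.le hα.le
  rw [add_sub_cancel, Real.div_rpow hx0 hm0.le, div_le_iff₀ (by positivity)] at hb
  refine le_trans hb (le_of_eq ?_)
  ring

end MaximallyMixed

section PartialTrace

lemma star_dotProduct_conjTranspose_mul_self_mulVec {m : Type*} [Fintype m]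
    (D : Matrix m n ℂ) (v : n → ℂ) :
    star v ⬝ᵥ ((Dᴴ * D) *ᵥ v) = ((∑ i, ‖(D *ᵥ v) i‖ ^ 2 : ℝ) : ℂ) := by
  rw [← Matrix.mulVec_mulVec, Matrix.dotProduct_mulVec, Matrix.vecMul_conjTranspose, star_star]
  simp [dotProduct, Complex.conj_mul']

/-- A positive operator is dominated by `|b|` times its reduction tensored with the identity. -/
lemma le_card_smul_one_kronecker_ptraceA {P : Matrix (b × r) (b × r) ℂ} (hP : 0 ≤ P) :
    P ≤ (Fintype.card b : ℝ) • ((1 : Matrix b b ℂ) ⊗ₖ ptraceA P) := by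
  obtain ⟨C, rfl⟩ := CStarAlgebra.nonneg_iff_eq_star_mul_self.mp hP
  let D : Matrix ((b × r) × b × b) (b × r) ℂ :=
    Matrix.of fun i j => if i.2.2 = j.1 then C i.1 (i.2.1, j.2) else 0
  have hD : (1 : Matrix b b ℂ) ⊗ₖ ptraceA (star C * C) = Dᴴ * D := by
    ext ⟨x, i⟩ ⟨y, j⟩
    by_cases hxy : x = y
    · subst hxy
      simp [D, ptraceA, Matrix.mul_apply, Matrix.star_eq_conjTranspose, Fintype.sum_prod_type,
        Matrix.kroneckerMap_apply]
      rw [Finset.sum_comm]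
      exact Finset.sum_congr rfl fun _ _ => Finset.sum_comm
    · simp [D, Matrix.mul_apply, Fintype.sum_prod_type, Matrix.kroneckerMap_apply, hxy]
      simp [Ne.symm hxy]
  rw [hD, Matrix.le_iff]
  refine Matrix.PosSemidef.of_dotProduct_mulVec_nonneg ?_ fun v => ?_
  · refine Matrix.IsHermitian.sub ?_ (Matrix.isHermitian_conjTranspose_mul_self C)
    exact ((Matrix.posSemidef_conjTranspose_mul_self D).smul (Nat.cast_nonneg (α := ℝ) _)).isHermitian
  have hCv (k : b × r) : (C *ᵥ v) k = ∑ x, (D *ᵥ v) (k, x, x) := by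
    simp [D, Matrix.mulVec, dotProduct, Fintype.sum_prod_type, ite_mul]
  rw [Matrix.sub_mulVec, dotProduct_sub, Matrix.smul_mulVec, dotProduct_smul,
    Matrix.star_eq_conjTranspose, star_dotProduct_conjTranspose_mul_self_mulVec,
    star_dotProduct_conjTranspose_mul_self_mulVec, sub_nonneg, Complex.real_smul]
  norm_cast
  rw [Fintype.sum_prod_type (fun i => ‖(D *ᵥ v) i‖ ^ 2), Finset.mul_sum]
  refine Finset.sum_le_sum fun k _ => ?_
  calc ‖(C *ᵥ v) k‖ ^ 2 ≤ (∑ x, ‖(D *ᵥ v) (k, x, x)‖) ^ 2 := by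
        rw [hCv]; gcongr; exact norm_sum_le _ _
    _ ≤ Fintype.card b * ∑ x, ‖(D *ᵥ v) (k, x, x)‖ ^ 2 := by
        simpa using sq_sum_le_card_mul_sum_sq (s := Finset.univ)
          (f := fun x => ‖(D *ᵥ v) (k, x, x)‖)
    _ ≤ Fintype.card b * ∑ y, ‖(D *ᵥ v) (k, y)‖ ^ 2 := by
        gcongr
        rw [Fintype.sum_prod_type]
        exact Finset.sum_le_sum fun x _ => Finset.single_le_sum
          (f := fun y => ‖(D *ᵥ v) (k, x, y)‖ ^ 2) (fun _ _ => by positivity) (Finset.mem_univ x)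

end PartialTrace

section Channel

variable {N : Matrix a a ℂ →ₗ[ℂ] Matrix b b ℂ}

lemma trace_tensorId (hN : ∀ ρ, Matrix.trace (N ρ) = Matrix.trace ρ)
    (ρ : Matrix (a × r) (a × r) ℂ) : Matrix.trace (tensorId N r ρ) = Matrix.trace ρ := by
  have h (i : r) := hN (Matrix.of fun x y => ρ (x, i) (y, i))
  simp only [Matrix.trace, Matrix.diag_apply, Matrix.of_apply] at h
  simp only [Matrix.trace, Matrix.diag_apply, Fintype.sum_prod_type_right, ← h]
  rfl

lemma tensorId_randomizing (hN : ∀ ρ, Matrix.trace (N ρ) = Matrix.trace ρ)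
    (ρ : Matrix (a × r) (a × r) ℂ) : tensorId (randomizing a b) r ρ =
      (Fintype.card b : ℝ)⁻¹ • ((1 : Matrix b b ℂ) ⊗ₖ ptraceA (tensorId N r ρ)) := by
  ext ⟨x, i⟩ ⟨y, j⟩
  have h := hN (Matrix.of fun x y => ρ (x, i) (y, j))
  have h1 : ptraceA (tensorId N r ρ) i j
      = Matrix.trace (Matrix.of fun x y => ρ (x, i) (y, j)) := by rw [← h]; rfl
  have h2 : tensorId (randomizing a b) r ρ (x, i) (y, j)
      = Matrix.trace (Matrix.of fun x y => ρ (x, i) (y, j)) * maxMixed b x y := rfl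
  rw [h2, Matrix.smul_apply, Matrix.kroneckerMap_apply, h1, maxMixed, Matrix.smul_apply,
    Complex.real_smul, smul_eq_mul]
  push_cast
  ring

variable {k : ℕ} {ρ : Matrix (a × Fin k) (a × Fin k) ℂ}

lemma IsChannel.tensorId_nonneg (hN : IsChannel N) (hρ : IsState ρ) :
    0 ≤ tensorId N (Fin k) ρ :=
  (hN.2 k ρ hρ.1).nonneg

lemma IsChannel.rtr_tensorId (hN : IsChannel N) (hρ : IsState ρ) :
    rtr (tensorId N (Fin k) ρ) = 1 := by
  rw [rtr, trace_tensorId hN.1, hρ.2, Complex.one_re]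

variable [Nonempty b]

lemma IsChannel.tensorId_le_smul_randomizing (hN : IsChannel N) (hρ : IsState ρ) :
    tensorId N (Fin k) ρ ≤
      ((Fintype.card b : ℝ) ^ 2) • tensorId (randomizing a b) (Fin k) ρ := by
  have hd : (Fintype.card b : ℝ) ≠ 0 := by positivity
  rw [tensorId_randomizing hN.1, smul_smul, sq, mul_assoc, mul_inv_cancel₀ hd, mul_one]
  exact le_card_smul_one_kronecker_ptraceA (hN.tensorId_nonneg hρ)

lemma IsChannel.tensorId_randomizing_nonneg (hN : IsChannel N) (hρ : IsState ρ) :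
    0 ≤ tensorId (randomizing a b) (Fin k) ρ := by
  have hd : (0 : ℝ) < (Fintype.card b : ℝ) ^ 2 := by positivity
  have h := (hN.tensorId_nonneg hρ).trans (hN.tensorId_le_smul_randomizing hρ)
  simpa [smul_smul, hd.ne'] using smul_nonneg (inv_nonneg.mpr hd.le) h

lemma IsChannel.sandTsallis_le {α : ℝ} (hα : α ∈ Set.Ioo (0 : ℝ) 2) (hα1 : α ≠ 1)
    (hN : IsChannel N) (hρ : IsState ρ) :
    sandTsallis α (tensorId N (Fin k) ρ) (tensorId (randomizing a b) (Fin k) ρ)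
      ≤ (α - 1)⁻¹ * (((Fintype.card b : ℝ) ^ 2) ^ (α - 1) - 1) := by
  have hd : (0 : ℝ) < (Fintype.card b : ℝ) ^ 2 := by positivity
  rw [sandTsallis]
  rcases hα1.lt_or_gt with h | h
  · have := le_sandTr_of_le_smul hα.1 h hd (hN.tensorId_nonneg hρ) (hN.rtr_tensorId hρ)
      (hN.tensorId_randomizing_nonneg hρ) (hN.tensorId_le_smul_randomizing hρ)
    exact mul_le_mul_of_nonpos_left (by linarith) (inv_nonpos.mpr (by linarith))
  · have := sandTr_le_of_le_smul h hα.2.le hd (hN.tensorId_nonneg hρ) (hN.rtr_tensorId hρ)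
      (hN.tensorId_randomizing_nonneg hρ) (hN.tensorId_le_smul_randomizing hρ)
    exact mul_le_mul_of_nonneg_left (by linarith) (inv_nonneg.mpr (by linarith))

lemma IsChannel.sandTsallis_nonneg_of_trivial_reference {α : ℝ} (hα : 0 < α) (hα1 : α ≠ 1)
    (hN : IsChannel N) {ρ : Matrix (a × Fin 1) (a × Fin 1) ℂ} (hρ : IsState ρ) :
    0 ≤ sandTsallis α (tensorId N (Fin 1) ρ) (tensorId (randomizing a b) (Fin 1) ρ) := by
  have hS : tensorId (randomizing a b) (Fin 1) ρ = (Fintype.card (b × Fin 1) : ℝ)⁻¹ • 1 := by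
    have h1 : ptraceA (tensorId N (Fin 1) ρ) = 1 := by
      ext i j
      have h := trace_tensorId hN.1 ρ
      rw [hρ.2, Matrix.trace, Fintype.sum_prod_type_right] at h
      rw [Subsingleton.elim i 0, Subsingleton.elim j 0, Matrix.one_apply_eq]
      simpa [ptraceA] using h
    rw [tensorId_randomizing hN.1, h1, Matrix.one_kronecker_one]
    simp
  rw [sandTsallis, hS]
  rcases hα1.lt_or_gt with h | h
  · have := sandTr_inv_card_smul_one_le_one hα h (hN.tensorId_nonneg hρ) (hN.rtr_tensorId hρ)
    exact mul_nonneg_of_nonpos_of_nonpos (inv_nonpos.mpr (by linarith)) (by linarith)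
  · have := one_le_sandTr_inv_card_smul_one h (hN.tensorId_nonneg hρ) (hN.rtr_tensorId hρ)
    exact mul_nonneg (inv_nonneg.mpr (by linarith)) (by linarith)

lemma isState_single (i : n) : IsState (Matrix.single i i (1 : ℂ)) := by
  refine ⟨?_, by simp⟩
  rw [← Matrix.diagonal_single]
  exact Matrix.PosSemidef.diagonal fun j => by by_cases h : j = i <;> simp [h]

lemma IsChannel.chSandTsallis_randomizing_mem_Icc [Nonempty a] {α : ℝ}
    (hα : α ∈ Set.Ioo (0 : ℝ) 2) (hα1 : α ≠ 1) (hN : IsChannel N) :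
    chSandTsallis α N (randomizing a b) ∈
      Set.Icc 0 ((α - 1)⁻¹ * (((Fintype.card b : ℝ) ^ 2) ^ (α - 1) - 1)) := by
  let p₀ : Σ k : ℕ, {ρ : Matrix (a × Fin k) (a × Fin k) ℂ // IsState ρ} :=
    ⟨1, _, isState_single (Classical.arbitrary a, 0)⟩
  have : Nonempty (Σ k : ℕ, {ρ : Matrix (a × Fin k) (a × Fin k) ℂ // IsState ρ}) := ⟨p₀⟩
  refine ⟨?_, ciSup_le fun p => hN.sandTsallis_le hα hα1 p.2.2⟩
  refine (hN.sandTsallis_nonneg_of_trivial_reference hα.1 hα1 p₀.2.2).trans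
    (le_ciSup (f := fun p : Σ k : ℕ, {ρ : Matrix (a × Fin k) (a × Fin k) ℂ // IsState ρ} =>
      sandTsallis α (tensorId N (Fin p.1) p.2.1) (tensorId (randomizing a b) (Fin p.1) p.2.1))
      ⟨(α - 1)⁻¹ * (((Fintype.card b : ℝ) ^ 2) ^ (α - 1) - 1), ?_⟩ p₀)
  rintro _ ⟨p, rfl⟩
  exact hN.sandTsallis_le hα hα1 p.2.2

end Channel

end MatrixAnalysis

theorem chTsallisEnt_bounds {A B : Type} [Fintype A] [DecidableEq A] [Nonempty A]
    [Fintype B] [DecidableEq B] [Nonempty B]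
    (α : ℝ) (hα : α ∈ Set.Ioo (0 : ℝ) 2) (hα1 : α ≠ 1)
    (N : Matrix A A ℂ →ₗ[ℂ] Matrix B B ℂ) (hN : IsChannel N) :
    -(((Fintype.card B : ℝ) ^ (α - 1) - 1) / (α - 1)) ≤ chTsallisEnt α N
      ∧ chTsallisEnt α N ≤ ((Fintype.card B : ℝ) ^ (1 - α) - 1) / (1 - α) := by
  obtain ⟨h0, h1⟩ := hN.chSandTsallis_randomizing_mem_Icc hα hα1
  have hd : (0 : ℝ) < Fintype.card B := by positivity
  have hpow : (0 : ℝ) < (Fintype.card B : ℝ) ^ (1 - α) := by positivity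
  rw [chTsallisEnt]
  refine ⟨?_, by have := mul_nonneg hpow.le h0; linarith⟩
  have hle := mul_le_mul_of_nonneg_left h1 hpow.le
  have hα0 : α - 1 ≠ 0 := sub_ne_zero.mpr hα1
  set q := (Fintype.card B : ℝ) ^ (α - 1) with hq
  have hq0 : 0 < q := by positivity
  have hinv : (Fintype.card B : ℝ) ^ (1 - α) = q⁻¹ := by
    rw [hq, ← Real.rpow_neg hd.le, neg_sub]
  have hsq : ((Fintype.card B : ℝ) ^ 2) ^ (α - 1) = q ^ 2 := by
    rw [sq, Real.mul_rpow hd.le hd.le, ← hq, sq]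
  rw [hsq, hinv] at hle
  rw [hinv]
  have key : q⁻¹ * ((α - 1)⁻¹ * (q ^ 2 - 1)) = (q⁻¹ - 1) / (1 - α) + (q - 1) / (α - 1) := by
    rw [← neg_sub α 1]
    field_simp
    ring
  linarith

end QIT
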